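/- Let w be a finite word over the alphabet {a,b} of the form w = a^{r_1} b a^{r_2} b ... a^{r_k} b a^{r_{k+1}}, where r_1, ..., r_{k+1} are nonnegative integers, with |w|_a ≥ |w|_b = k ≥ 1. Let δ = |w|_a − k, and write δ = n(k+1) + i with n ≥ 0 and 0 ≤ i ≤ k. Let σ be a permutation of {1, ..., k+1} with r_{σ(1)} ≤ ... ≤ r_{σ(k+1)}. If s(w) + 1 + ⌊3n/2 + 3i/(2(k+1))⌋ ≤ m(w) + r_{σ(k)}, then s(w) ≤ ((2k−1)/(2k+2))·|w|. -/

import Mathlib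

/-- `numPowers w` is the number of distinct nonempty factors of `w` that are
powers of exponent at least 2, i.e. of the form `u^j` with `u` nonempty and `j ≥ 2`. -/
noncomputable def numPowers {α : Type*} (w : List α) : ℕ :=
  Set.ncard {v : List α | v <:+: w ∧
    ∃ u : List α, u ≠ [] ∧ ∃ j : ℕ, 2 ≤ j ∧ v = (List.replicate j u).flatten}

/-- `numSquares w` is the number of distinct squares occurring as factors of `w`. -/
noncomputable def numSquares {α : Type*} (w : List α) : ℕ :=
  Set.ncard {v : List α | v <:+: w ∧ ∃ u : List α, u ≠ [] ∧ v = u ++ u}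

/-- The binary word `a^{r 0} b a^{r 1} b ⋯ a^{r (k-1)} b a^{r k}` over the
alphabet `Bool`, where `a := false` and `b := true`. -/
def binWord (k : ℕ) (r : Fin (k + 1) → ℕ) : List Bool :=
  (List.ofFn (fun j : Fin k => List.replicate (r j.castSucc) false ++ [true])).flatten
    ++ List.replicate (r (Fin.last k)) false

section Windows

variable {α : Type*}

/-- The word `f s, f (s + 1), …, f (s + L - 1)`. -/
def window (f : ℕ → α) (s L : ℕ) : List α := (List.range' s L).map f

@[simp] theorem length_window (f : ℕ → α) (s L : ℕ) : (window f s L).length = L := by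
  simp [window]

theorem window_add (f : ℕ → α) (s L M : ℕ) :
    window f s (L + M) = window f s L ++ window f (s + L) M := by
  simp [window, ← List.map_append]

theorem tail_window (f : ℕ → α) (s L : ℕ) : (window f s (L + 1)).tail = window f (s + 1) L := by
  simp [window, List.range'_succ]

theorem dropLast_window (f : ℕ → α) (s L : ℕ) :
    (window f s (L + 1)).dropLast = window f s L := by
  rw [window_add]
  simp [window]

theorem window_eq_window_iff {f g : ℕ → α} {s t L : ℕ} :
    window f s L = window g t L ↔ ∀ i < L, f (s + i) = g (t + i) := by
  constructor
  · intro h i hi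
    have := congrArg (fun l => l[i]?) h
    simpa [window, hi] using this
  · intro h
    apply List.ext_getElem <;> simp +contextual [window, h]

theorem window_infix (f : ℕ → α) {s i L M : ℕ} (h : i + M ≤ L) :
    window f (s + i) M <:+: window f s L := by
  obtain ⟨N, rfl⟩ := Nat.exists_eq_add_of_le h
  rw [window_add, window_add]
  exact ⟨_, _, rfl⟩

theorem window_add_period {f : ℕ → α} {p : ℕ} (hf : Function.Periodic f p) (s L : ℕ) :
    window f (s + p) L = window f s L := by
  rw [window_eq_window_iff]
  intro i _
  rw [add_right_comm, hf]

theorem Function.Periodic.apply_add_mul {f : ℕ → α} {p : ℕ} (hf : Function.Periodic f p)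
    (i c : ℕ) : f (i + c * p) = f i := by
  simpa using hf.nat_mul c i

theorem window_add_mul_period {f : ℕ → α} {p : ℕ} (hf : Function.Periodic f p) (s c L : ℕ) :
    window f (s + c * p) L = window f s L := by
  rw [window_eq_window_iff]
  intro i _
  rw [add_right_comm, hf.apply_add_mul]

theorem window_mod_period {f : ℕ → α} {p : ℕ} (hf : Function.Periodic f p) (s L : ℕ) :
    window f (s % p) L = window f s L := by
  conv_rhs => rw [← Nat.mod_add_div s p, mul_comm, window_add_mul_period hf]

theorem exists_window_eq_of_infix {v w : List α} (h : v <:+: w) (d : α) :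
    ∃ s, s + v.length ≤ w.length ∧ v = window (fun i => w.getD i d) s v.length := by
  obtain ⟨x, y, rfl⟩ := h
  refine ⟨x.length, by simp, ?_⟩
  apply List.ext_getElem
  · simp
  · intro i h1 h2
    simp only [window, List.getElem_map, List.getElem_range', List.getD_eq_getElem?_getD,
      List.append_assoc]
    rw [List.getElem?_append_right (by omega), List.getElem?_append_left (by omega)]
    simp [h1]

theorem window_getD_infix (w : List α) (d : α) {s L : ℕ} (h : s + L ≤ w.length) :
    window (fun i => w.getD i d) s L <:+: w := by
  have hw : window (fun i => w.getD i d) 0 w.length = w := by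
    apply List.ext_getElem <;> simp +contextual [window]
  have := window_infix (fun i => w.getD i d) (s := 0) (i := s) h
  rwa [hw, zero_add] at this

end Windows

section Lex

variable {α : Type*} [LinearOrder α]

theorem List.append_lt_append_of_lt {a b : List α} (h : a < b) (hl : a.length = b.length)
    (c d : List α) : a ++ c < b ++ d := by
  induction a generalizing b with
  | nil =>
    cases b with
    | nil => exact absurd h (lt_irrefl _)
    | cons => simp at hl
  | cons x a ih =>
    cases b with
    | nil => simp at hl
    | cons y b =>
      rw [List.cons_append, List.cons_append, List.cons_lt_cons_iff]
      rw [List.cons_lt_cons_iff] at h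
      rcases h with h | ⟨rfl, h⟩
      · exact Or.inl h
      · exact Or.inr ⟨rfl, ih h (by simpa using hl)⟩

theorem List.lt_of_append_lt_append_left {a c d : List α} (h : a ++ c < a ++ d) : c < d := by
  induction a with
  | nil => simpa using h
  | cons x a ih =>
    rw [List.cons_append, List.cons_append, List.cons_lt_cons_iff] at h
    exact ih (h.resolve_left (lt_irrefl _)).2

end Lex

section Links

variable {β ε : Type*}

/-- `u` and `v` are in the same connected component of the graph whose edges are the elements
of `N`, the edge `e` joining `src e` and `tgt e`. -/
def Linked (src tgt : ε → β) (N : Set ε) : β → β → Prop :=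
  Relation.EqvGen fun u v => ∃ e ∈ N, src e = u ∧ tgt e = v

variable {src tgt : ε → β}

theorem Linked.bind {M N : Set ε} (hMN : ∀ e ∈ M, Linked src tgt N (src e) (tgt e)) {u v : β}
    (h : Linked src tgt M u v) : Linked src tgt N u v := by
  induction h with
  | rel u v h =>
    obtain ⟨e, he, rfl, rfl⟩ := h
    exact hMN e he
  | refl u => exact .refl u
  | symm u v _ ih => exact .symm _ _ ih
  | trans u v x _ _ ih₁ ih₂ => exact .trans _ _ _ ih₁ ih₂

theorem linked_insert {N : Set ε} {e : ε} {u v : β} (h : Linked src tgt (insert e N) u v) :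
    Linked src tgt N u v ∨
      Linked src tgt N u (src e) ∧ Linked src tgt N v (tgt e) ∨
      Linked src tgt N u (tgt e) ∧ Linked src tgt N v (src e) := by
  induction h with
  | rel u v h =>
    obtain ⟨x, rfl | hx, rfl, rfl⟩ := h
    · exact .inr (.inl ⟨.refl _, .refl _⟩)
    · exact .inl (.rel _ _ ⟨x, hx, rfl, rfl⟩)
  | refl u => exact .inl (.refl u)
  | symm u v _ ih =>
    rcases ih with h | ⟨h, h'⟩ | ⟨h, h'⟩
    · exact .inl (.symm _ _ h)
    · exact .inr (.inr ⟨h', h⟩)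
    · exact .inr (.inl ⟨h', h⟩)
  | trans u v x _ _ ih₁ ih₂ =>
    have tr : ∀ {a b c}, Linked src tgt N a b → Linked src tgt N b c → Linked src tgt N a c :=
      fun h h' => .trans _ _ _ h h'
    have sy : ∀ {a b}, Linked src tgt N a b → Linked src tgt N b a := fun h => .symm _ _ h
    rcases ih₁ with h | ⟨h, h'⟩ | ⟨h, h'⟩ <;> rcases ih₂ with g | ⟨g, g'⟩ | ⟨g, g'⟩
    · exact .inl (tr h g)
    · exact .inr (.inl ⟨tr h g, g'⟩)
    · exact .inr (.inr ⟨tr h g, g'⟩)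
    · exact .inr (.inl ⟨h, tr (sy g) h'⟩)
    · exact .inl (tr h (tr (tr (sy g) h') (sy g')))
    · exact .inl (tr h (sy g'))
    · exact .inr (.inr ⟨h, tr (sy g) h'⟩)
    · exact .inl (tr h (sy g'))
    · exact .inl (tr h (tr (tr (sy g) h') (sy g')))

theorem exists_independent_subset (src tgt : ε → β) (S : Finset β) (N : Finset ε) :
    ∃ T ⊆ S, S.card ≤ T.card + N.card ∧
      ∀ u ∈ T, ∀ v ∈ T, Linked src tgt (N : Set ε) u v → u = v := by
  classical
  induction N using Finset.induction_on with
  | empty =>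
    refine ⟨S, subset_rfl, by simp, fun u _ v _ h => ?_⟩
    rw [Finset.coe_empty] at h
    clear * - h
    induction h with
    | rel u v h => simp at h
    | refl u => rfl
    | symm u v _ ih => exact ih.symm
    | trans u v x _ _ ih₁ ih₂ => exact ih₁.trans ih₂
  | insert e N he ih =>
    obtain ⟨T, hTS, hcard, hT⟩ := ih
    refine ⟨T.filter fun v => ¬ Linked src tgt (N : Set ε) v (src e),
      (Finset.filter_subset _ _).trans hTS, ?_, ?_⟩
    · have h1 : (T.filter fun v => Linked src tgt (N : Set ε) v (src e)).card ≤ 1 := by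
        rw [Finset.card_le_one]
        simp only [Finset.mem_filter]
        exact fun u hu v hv => hT u hu.1 v hv.1 (.trans _ _ _ hu.2 (.symm _ _ hv.2))
      have h2 := Finset.card_filter_add_card_filter_not (s := T)
        (fun v => Linked src tgt (N : Set ε) v (src e))
      rw [Finset.card_insert_of_notMem he]
      omega
    · simp only [Finset.mem_filter, Finset.coe_insert]
      intro u hu v hv h
      rcases linked_insert h with h | ⟨h, -⟩ | ⟨-, h⟩
      · exact hT u hu.1 v hv.1 h
      · exact absurd h hu.2
      · exact absurd h hv.2

theorem card_le_card_add_one_of_linked {S : Finset β} {N : Finset ε}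
    (h : ∀ u ∈ S, ∀ v ∈ S, Linked src tgt (N : Set ε) u v) : S.card ≤ N.card + 1 := by
  obtain ⟨T, hTS, hcard, hT⟩ := exists_independent_subset src tgt S N
  have : T.card ≤ 1 := Finset.card_le_one.2 fun u hu v hv =>
    hT u hu v hv (h u (hTS hu) v (hTS hv))
  omega

theorem linked_window {α : Type*} {f : ℕ → α} {E : Set (List α)} {l a b : ℕ} (hab : a ≤ b)
    (h : ∀ s, a ≤ s → s < b → window f s (l + 1) ∈ E) :
    Linked List.dropLast List.tail E (window f a l) (window f b l) := by
  induction b, hab using Nat.le_induction with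
  | base => exact .refl _
  | succ b hb ih =>
    exact .trans _ _ _ (ih fun s h1 h2 => h s h1 (by omega)) <|
      .rel _ _ ⟨_, h b hb (by omega), dropLast_window f b l, tail_window f b l⟩

end Links

section Removable

variable {α : Type*} [LinearOrder α]

/-- The factors of `w`. -/
def factors (w : List α) : Finset (List α) := w.sublists.toFinset.filter (· <:+: w)

@[simp] theorem mem_factors {v w : List α} : v ∈ factors w ↔ v <:+: w := by
  simp only [factors, Finset.mem_filter, List.mem_toFinset, List.mem_sublists, and_iff_right_iff_imp]
  exact List.IsInfix.sublist

/-- The factors of `w` of length `L`: the vertices of the Rauzy graph of order `L`. -/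
def factorsOfLength (w : List α) (L : ℕ) : Finset (List α) :=
  (factors w).filter (·.length = L)

theorem mem_factorsOfLength {v w : List α} {L : ℕ} :
    v ∈ factorsOfLength w L ↔ v <:+: w ∧ v.length = L := by
  simp [factorsOfLength]

/-- `x`, seen as an edge of a Rauzy graph of `w`, can be bypassed using lexicographically larger
edges. -/
def Removable (w x : List α) : Prop :=
  Linked List.dropLast List.tail {e | e <:+: w ∧ e.length = x.length ∧ x < e} x.dropLast x.tail

theorem linked_factorsOfLength {w u v : List α} {l : ℕ} (hu : u ∈ factorsOfLength w l)
    (hv : v ∈ factorsOfLength w l) :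
    Linked List.dropLast List.tail (factorsOfLength w (l + 1) : Set (List α)) u v := by
  rcases w.eq_nil_or_concat with rfl | ⟨_, d, -⟩
  · simp only [mem_factorsOfLength, List.infix_nil] at hu hv
    rw [hu.1, hv.1]
    exact .refl _
  wlog hst : ∃ s t, s ≤ t ∧ t + l ≤ w.length ∧ u = window (fun i => w.getD i d) s l ∧
      v = window (fun i => w.getD i d) t l generalizing u v
  · obtain ⟨hu1, rfl⟩ := mem_factorsOfLength.1 hu
    obtain ⟨hv1, hv2⟩ := mem_factorsOfLength.1 hv
    obtain ⟨s, hs, hus⟩ := exists_window_eq_of_infix hu1 d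
    obtain ⟨t, ht, hvt⟩ := exists_window_eq_of_infix hv1 d
    rw [hv2] at hvt ht
    rcases le_total s t with h | h
    · exact absurd ⟨s, t, h, ht, hus, hvt⟩ hst
    · exact .symm _ _ (this hv hu ⟨t, s, h, hs, hvt, hus⟩)
  · obtain ⟨s, t, hst, ht, rfl, rfl⟩ := hst
    refine linked_window hst fun i _ hi => ?_
    rw [Finset.mem_coe, mem_factorsOfLength]
    exact ⟨window_getD_infix w d (by omega), by simp⟩

open Classical in
theorem linked_not_removable {w : List α} {L : ℕ} {x : List α} (hx : x ∈ factorsOfLength w L) :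
    Linked List.dropLast List.tail
      (((factorsOfLength w L).filter fun e => ¬ Removable w e : Finset _) : Set (List α))
      x.dropLast x.tail := by
  induction hc : ((factorsOfLength w L).filter (x < ·)).card using Nat.strong_induction_on
    generalizing x with
  | _ c ih =>
  by_cases hr : Removable w x
  · refine Linked.bind ?_ hr
    rintro e ⟨he, hel, hxe⟩
    have hx2 := (mem_factorsOfLength.1 hx).2
    have he' : e ∈ factorsOfLength w L := mem_factorsOfLength.2 ⟨he, hel.trans hx2⟩
    refine ih _ ?_ he' rfl
    rw [← hc]
    apply Finset.card_lt_card
    rw [Finset.ssubset_iff_of_subset]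
    · exact ⟨e, by simp [he', hxe], by simp⟩
    · exact Finset.monotone_filter_right _ fun y _ hy => hxe.trans hy
  · exact .rel _ _ ⟨x, by simp [hx, hr], rfl, rfl⟩

open Classical in
theorem card_removable_add_card_le (w : List α) (l : ℕ) :
    ((factorsOfLength w (l + 1)).filter (Removable w)).card + (factorsOfLength w l).card ≤
      (factorsOfLength w (l + 1)).card + 1 := by
  have h1 := card_le_card_add_one_of_linked (src := List.dropLast) (tgt := List.tail)
    (S := factorsOfLength w l)
    (N := (factorsOfLength w (l + 1)).filter fun e => ¬ Removable w e) fun u hu v hv =>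
      Linked.bind (fun e he => linked_not_removable he) (linked_factorsOfLength hu hv)
  have h2 := Finset.card_filter_add_card_filter_not (s := factorsOfLength w (l + 1)) (Removable w)
  omega

open Classical in
/-- The removable factors of `w` of length at least `2`. -/
noncomputable def removableFactors (w : List α) : Finset (List α) :=
  (factors w).filter fun x => 2 ≤ x.length ∧ Removable w x

theorem mem_removableFactors {w x : List α} :
    x ∈ removableFactors w ↔ x <:+: w ∧ 2 ≤ x.length ∧ Removable w x := by
  simp [removableFactors]

theorem card_removableFactors_add_card_le {w : List α} (hw : w ≠ []) :
    (removableFactors w).card + (factorsOfLength w 1).card ≤ w.length := by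
  classical
  have key : ∀ M, ((removableFactors w).filter (·.length ≤ M + 1)).card +
      (factorsOfLength w 1).card ≤ (factorsOfLength w (M + 1)).card + M := by
    intro M
    induction M with
    | zero =>
      have : (removableFactors w).filter (·.length ≤ 0 + 1) = ∅ := by
        ext x
        simp only [Finset.mem_filter, mem_removableFactors, Finset.notMem_empty, iff_false]
        omega
      simp [this]
    | succ M ih =>
      have hsub : (removableFactors w).filter (·.length ≤ M + 1 + 1) ⊆
          (removableFactors w).filter (·.length ≤ M + 1) ∪
            (factorsOfLength w (M + 1 + 1)).filter (Removable w) := by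
        intro x
        simp only [Finset.mem_filter, mem_removableFactors, Finset.mem_union, mem_factorsOfLength]
        rintro ⟨⟨h1, h2, h3⟩, h4⟩
        rcases h4.lt_or_eq with h5 | h5
        · exact .inl ⟨⟨h1, h2, h3⟩, by omega⟩
        · exact .inr ⟨⟨h1, h5⟩, h3⟩
      have h1 := (Finset.card_le_card hsub).trans (Finset.card_union_le _ _)
      have h2 := card_removable_add_card_le w (M + 1)
      omega
  have hpos : 0 < w.length := List.length_pos_iff.2 hw
  have h := key (w.length - 1)
  rw [Nat.sub_add_cancel hpos, Finset.filter_true_of_mem fun x hx =>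
    (mem_removableFactors.1 hx).1.length_le] at h
  have hone : (factorsOfLength w w.length).card ≤ 1 := by
    rw [Finset.card_le_one]
    intro u hu v hv
    rw [mem_factorsOfLength] at hu hv
    rw [hu.1.eq_of_length hu.2, hv.1.eq_of_length hv.2]
  omega

end Removable

section Powers

variable {α : Type*} [LinearOrder α]

/-- `g` is the infinite power of a Lyndon word of length `p`. -/
structure IsLyndonPower (g : ℕ → α) (p : ℕ) : Prop where
  pos : 0 < p
  periodic : Function.Periodic g p
  lt : ∀ t, 0 < t → t < p → window g 0 p < window g t p

theorem IsLyndonPower.window_lt {g : ℕ → α} {p t L : ℕ} (h : IsLyndonPower g p) (ht : 0 < t)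
    (htp : t < p) (hL : p ≤ L) : window g 0 L < window g t L := by
  obtain ⟨M, rfl⟩ := Nat.exists_eq_add_of_le hL
  rw [window_add, window_add]
  exact List.append_lt_append_of_lt (h.lt t ht htp) (by simp) _ _

theorem IsLyndonPower.period_le {g g' : ℕ → α} {p q L : ℕ} (h : IsLyndonPower g p)
    (h' : IsLyndonPower g' q) (hL : q ≤ L) (heq : window g 0 L = window g' 0 L) : q ≤ p := by
  by_contra! hpq
  obtain ⟨d, rfl⟩ := Nat.exists_eq_add_of_le hpq.le
  have hp := h.pos
  have hgg : ∀ i < L, g i = g' i := by simpa using window_eq_window_iff.1 heq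
  have hborder : window g' p d = window g' 0 d := by
    rw [window_eq_window_iff]
    intro i hi
    rw [← hgg _ (by omega), zero_add, ← hgg _ (by omega), add_comm, h.periodic]
  have hwrap : ∀ M, window g' (p + d) M = window g' 0 M := fun M => by
    simpa using window_add_period h'.periodic 0 M
  have h1 := h'.lt p hp (by omega)
  have h2 := h'.lt d (by omega) (by omega)
  have e1 : window g' 0 (p + d) = window g' 0 d ++ window g' d p := by
    rw [add_comm, window_add, zero_add]
  have e2 : window g' p (p + d) = window g' 0 d ++ window g' 0 p := by
    rw [add_comm p d, window_add, hborder, hwrap]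
  have e3 : window g' 0 (p + d) = window g' 0 p ++ window g' 0 d := by
    rw [window_add, zero_add, hborder]
  have e4 : window g' d (p + d) = window g' d p ++ window g' 0 d := by
    rw [window_add, add_comm d p, hwrap]
  rw [e1, e2] at h1
  rw [e3, e4] at h2
  exact lt_asymm h2
    (List.append_lt_append_of_lt (List.lt_of_append_lt_append_left h1) (by simp) _ _)

theorem IsLyndonPower.eq {g g' : ℕ → α} {p q L : ℕ} (h : IsLyndonPower g p)
    (h' : IsLyndonPower g' q) (hpL : p ≤ L) (hqL : q ≤ L) (heq : window g 0 L = window g' 0 L) :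
    p = q ∧ g = g' := by
  obtain rfl : p = q := le_antisymm (h'.period_le h hpL heq.symm) (h.period_le h' hqL heq)
  refine ⟨rfl, funext fun i => ?_⟩
  rw [← h.periodic.map_mod_nat, ← h'.periodic.map_mod_nat]
  simpa using window_eq_window_iff.1 heq (i % p) ((Nat.mod_lt _ h.pos).trans_le hpL)

theorem exists_isLyndonPower {f : ℕ → α} {p : ℕ} (hp : 0 < p) (hf : Function.Periodic f p)
    (hmin : ∀ q, 0 < q → q < p → ¬ Function.Periodic f q) :
    ∃ g s, IsLyndonPower g p ∧ ∀ L, window f 0 L = window g s L := by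
  obtain ⟨m, hm, hle⟩ := (Finset.range p).exists_min_image (fun s => window f s p)
    ⟨0, Finset.mem_range.2 hp⟩
  rw [Finset.mem_range] at hm
  have hwin : ∀ t L, window (fun i => f (m + i)) t L = window f (m + t) L := fun t L => by
    rw [window_eq_window_iff]
    intros
    rw [add_assoc]
  refine ⟨fun i => f (m + i), p - m, ⟨hp, fun i => ?_, fun t ht htp => ?_⟩, fun L => ?_⟩
  · rw [← add_assoc, hf]
  · rw [hwin, hwin]
    refine lt_of_le_of_ne ?_ fun heq => hmin t ht htp fun i => ?_
    · rw [← window_mod_period hf (m + t)]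
      exact hle _ (Finset.mem_range.2 (Nat.mod_lt _ hp))
    · have key : ∀ j, f (m + t + j) = f (m + j) := fun j => by
        have := window_eq_window_iff.1 heq (j % p) (Nat.mod_lt _ hp)
        rw [add_zero] at this
        rw [← Nat.mod_add_div j p, mul_comm, ← add_assoc, ← add_assoc]
        rw [hf.apply_add_mul, hf.apply_add_mul, this]
      have h1 := key (i + (p - m))
      rw [show m + t + (i + (p - m)) = i + t + p by omega, hf,
        show m + (i + (p - m)) = i + p by omega, hf] at h1
      exact h1
  · rw [hwin, show m + (p - m) = 0 + p by omega, window_add_period hf]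

/-- `v` is a power of exponent at least `2`. -/
def IsPower (v : List α) : Prop :=
  ∃ u : List α, u ≠ [] ∧ ∃ j : ℕ, 2 ≤ j ∧ v = (List.replicate j u).flatten

theorem IsPower.exists_isLyndonPower {v : List α} (hv : IsPower v) :
    ∃ g p j s, IsLyndonPower g p ∧ 2 ≤ j ∧ v = window g s (j * p) := by
  obtain ⟨u, hu, j, hj, rfl⟩ := hv
  have hlen : 0 < u.length := List.length_pos_iff.2 hu
  set f : ℕ → α := fun i => u[i % u.length]'(Nat.mod_lt _ hlen) with hfdef
  have hf : Function.Periodic f u.length := fun i => by simp [hfdef]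
  have hex : ∃ p, 0 < p ∧ Function.Periodic f p := ⟨_, hlen, hf⟩
  classical
  obtain ⟨hp, hfp⟩ := Nat.find_spec hex
  have hmin : ∀ q, 0 < q → q < Nat.find hex → ¬ Function.Periodic f q := fun q h1 h2 h3 =>
    Nat.find_min hex h2 ⟨h1, h3⟩
  set p := Nat.find hex
  obtain ⟨c, hc⟩ : p ∣ u.length := by
    rw [Nat.dvd_iff_mod_eq_zero]
    by_contra hne
    refine hmin _ (Nat.pos_of_ne_zero hne) (Nat.mod_lt _ hp) fun i => ?_
    rw [← hfp.apply_add_mul _ (u.length / p), mul_comm, add_assoc, Nat.mod_add_div, hf]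
  have hc0 : 0 < c := Nat.pos_of_ne_zero fun h => by simp [h, hu] at hc
  obtain ⟨g, s, hg, hs⟩ := _root_.exists_isLyndonPower hp hfp hmin
  have hflat : ∀ n, (List.replicate n u).flatten = window f 0 (n * u.length) := fun n => by
    induction n with
    | zero => simp [window]
    | succ n ih =>
      rw [List.replicate_succ', List.flatten_append, ih, add_mul, one_mul, window_add,
        window_add_mul_period hf, List.flatten_singleton]
      congr 1
      apply List.ext_getElem
      · simp
      · intro i h1 h2
        simp [window, hfdef, Nat.mod_eq_of_lt h1]
  refine ⟨g, p, j * c, s, hg, by nlinarith, ?_⟩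
  rw [← hs, hflat, hc]
  congr 1
  ring

end Powers

section Injection

variable {α : Type*} [LinearOrder α]

open Classical in
/-- The factors of `w` that are conjugates of the `j`-th power of the prefix of length `p`
of `g`. -/
noncomputable def conjugates (w : List α) (g : ℕ → α) (p j : ℕ) : Finset (List α) :=
  (factors w).filter fun z => ∃ s, z = window g s (j * p)

theorem mem_conjugates {w z : List α} {g : ℕ → α} {p j : ℕ} :
    z ∈ conjugates w g p j ↔ z <:+: w ∧ ∃ s, z = window g s (j * p) := by
  simp [conjugates]

/-- The number of conjugates of `v` among the factors of `w` smaller than `v`. -/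
noncomputable def conjugateRank (w : List α) (g : ℕ → α) (p j : ℕ) (v : List α) : ℕ :=
  ((conjugates w g p j).filter (· < v)).card

theorem conjugateRank_lt_card {w v : List α} {g : ℕ → α} {p j : ℕ}
    (hv : v ∈ conjugates w g p j) :
    conjugateRank w g p j v < (conjugates w g p j).card := by
  apply Finset.card_lt_card
  rw [Finset.ssubset_iff_of_subset (Finset.filter_subset _ _)]
  exact ⟨v, hv, by simp⟩

theorem conjugateRank_injOn (w : List α) (g : ℕ → α) (p j : ℕ) :
    Set.InjOn (conjugateRank w g p j) (conjugates w g p j) := by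
  have mono : ∀ u ∈ conjugates w g p j, ∀ v, u < v →
      conjugateRank w g p j u < conjugateRank w g p j v := by
    intro u hu v huv
    apply Finset.card_lt_card
    rw [Finset.ssubset_iff_of_subset
      (Finset.monotone_filter_right _ fun _ _ hy => lt_trans hy huv)]
    exact ⟨u, by simp [hu, huv], by simp⟩
  intro u hu v hv huv
  rcases lt_trichotomy u v with h | h | h
  · exact absurd huv (mono u hu v h).ne
  · exact h
  · exact absurd huv (mono v hv u h).ne'

theorem card_conjugates_le {g : ℕ → α} {p : ℕ} (hp : 0 < p) (hg : Function.Periodic g p)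
    (w : List α) (j : ℕ) : (conjugates w g p j).card ≤ p := by
  have hsub : conjugates w g p j ⊆ (Finset.range p).image fun s => window g s (j * p) := by
    intro z hz
    obtain ⟨-, s, rfl⟩ := mem_conjugates.1 hz
    exact Finset.mem_image.2 ⟨s % p, Finset.mem_range.2 (Nat.mod_lt _ hp), window_mod_period hg _ _⟩
  simpa using (Finset.card_le_card hsub).trans Finset.card_image_le

theorem window_infix_of_lt_card_conjugates {w : List α} {g : ℕ → α} {p j t : ℕ} (hp : 0 < p)
    (hg : Function.Periodic g p) (ht : t < (conjugates w g p (j + 1)).card) (q : ℕ) :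
    window g q (j * p + t + 1) <:+: w := by
  have himg : ((Finset.range t).image fun i => window g (q + 1 + i) ((j + 1) * p)).card <
      (conjugates w g p (j + 1)).card :=
    (Finset.card_image_le.trans (Finset.card_range t).le).trans_lt ht
  obtain ⟨z, hz, hzn⟩ := Finset.exists_mem_notMem_of_card_lt_card himg
  obtain ⟨hzw, s, rfl⟩ := mem_conjugates.1 hz
  obtain ⟨i, hip, hi⟩ : ∃ i < p, window g s ((j + 1) * p) = window g (q + 1 + i) ((j + 1) * p) := by
    refine ⟨(s + (q + 1) * (p - 1)) % p, Nat.mod_lt _ hp, ?_⟩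
    rw [← window_mod_period hg (q + 1 + _), Nat.add_mod_mod, window_mod_period hg]
    obtain ⟨p, rfl⟩ := Nat.exists_eq_succ_of_ne_zero hp.ne'
    rw [show q + 1 + (s + (q + 1) * (p.succ - 1)) = s + (q + 1) * p.succ by
      simp only [Nat.succ_eq_add_one, Nat.add_sub_cancel]; ring, window_add_mul_period hg]
  have hti : t ≤ i := by
    by_contra! hlt
    exact hzn (Finset.mem_image.2 ⟨i, Finset.mem_range.2 hlt, hi.symm⟩)
  rw [hi] at hzw
  rw [← window_add_period hg, show q + p = q + 1 + i + (p - 1 - i) by omega]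
  refine (window_infix g ?_).trans hzw
  rw [add_mul, one_mul]
  omega

theorem removable_window {w : List α} {g : ℕ → α} {p l : ℕ} (hg : IsLyndonPower g p) (hpl : p ≤ l)
    (h : ∀ q, window g q (l + 1) <:+: w) : Removable w (window g 0 (l + 1)) := by
  have hp := hg.pos
  have key := linked_window (f := g) (l := l) (a := 1) (b := p)
    (E := {e | e <:+: w ∧ e.length = (window g 0 (l + 1)).length ∧ window g 0 (l + 1) < e}) hp
    fun s h1 h2 => ⟨h s, by simp, hg.window_lt h1 h2 (by omega)⟩
  rw [Removable, dropLast_window, tail_window, ← window_add_period hg.periodic 0 l, zero_add]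
  exact .symm _ _ key

theorem exists_injOn_isPower (w : List α) : ∃ F : List α → List α,
    Set.InjOn F {v | v <:+: w ∧ IsPower v} ∧ ∀ v, v <:+: w → IsPower v →
      F v ∈ removableFactors w ∧ ∀ l a b, a ≠ b → F v ≠ List.replicate l a ++ [b] := by
  classical
  rcases isEmpty_or_nonempty α with hα | hα
  · refine ⟨id, Function.injective_id.injOn, ?_⟩
    rintro v - ⟨u, hu, -⟩
    exact isEmptyElim (u.head hu)
  choose! g p j s hg hj hv using fun (v : List α) (hv : IsPower v) => hv.exists_isLyndonPower
  have hmem : ∀ v, v <:+: w → IsPower v → v ∈ conjugates w (g v) (p v) (j v - 1 + 1) := by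
    intro v hw hP
    rw [Nat.sub_add_cancel (by have := hj v hP; omega)]
    exact mem_conjugates.2 ⟨hw, s v, hv v hP⟩
  let t v := conjugateRank w (g v) (p v) (j v - 1 + 1) v
  have htp : ∀ v, v <:+: w → IsPower v → t v < p v := fun v hw hP =>
    (conjugateRank_lt_card (hmem v hw hP)).trans_le
      (card_conjugates_le (hg v hP).pos (hg v hP).periodic _ _)
  have hpl : ∀ v, IsPower v → p v ≤ (j v - 1) * p v + t v := fun v hP => by
    have : 1 * p v ≤ (j v - 1) * p v := Nat.mul_le_mul_right _ (by have := hj v hP; omega)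
    omega
  refine ⟨fun v => window (g v) 0 ((j v - 1) * p v + t v + 1), ?_, ?_⟩
  · rintro v ⟨hvw, hvP⟩ v' ⟨hvw', hvP'⟩ heq
    dsimp only at heq
    have hlen : (j v - 1) * p v + t v = (j v' - 1) * p v' + t v' := by
      simpa using congrArg List.length heq
    rw [← hlen] at heq
    obtain ⟨hpp, hgg⟩ := (hg v hvP).eq (hg v' hvP') (by have := hpl v hvP; omega)
      (by have := hpl v' hvP'; omega) heq
    have ht1 := htp v hvw hvP
    have ht2 := htp v' hvw' hvP'
    rw [← hpp] at hlen ht2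
    have hjj : j v - 1 = j v' - 1 := by
      have := congrArg (· / p v) hlen
      simpa [Nat.mul_add_div (hg v hvP).pos, mul_comm, Nat.div_eq_of_lt ht1,
        Nat.div_eq_of_lt ht2] using this
    have htt : t v = t v' := by rw [hjj] at hlen; omega
    have h1 := hmem v hvw hvP
    have h2 := hmem v' hvw' hvP'
    simp only [t] at htt
    rw [← hjj, ← hgg, ← hpp] at h2 htt
    exact conjugateRank_injOn _ _ _ _ h1 h2 htt
  · intro v hvw hvP
    have hinf := window_infix_of_lt_card_conjugates (hg v hvP).pos (hg v hvP).periodic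
      (conjugateRank_lt_card (hmem v hvw hvP))
    have hpl := hpl v hvP
    have hp := (hg v hvP).pos
    refine ⟨mem_removableFactors.2 ⟨hinf 0, ?_, removable_window (hg v hvP) hpl hinf⟩, ?_⟩
    · rw [length_window]
      omega
    · intro l a b hab heq
      dsimp only at heq
      have hl : (j v - 1) * p v + t v = l := by simpa using congrArg List.length heq
      rw [hl] at heq hpl
      have h1 : g v l = b := by
        have := congrArg (fun x => x[l]?) heq
        simpa [window] using this
      have h2 : g v (l - p v) = a := by
        have := congrArg (fun x => x[l - p v]?) heq
        simpa [window, List.getElem?_append, show l - p v < l by omega,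
          show l - p v < l + 1 by omega] using this
      rw [← (hg v hvP).periodic, Nat.sub_add_cancel hpl] at h2
      exact hab (h2.symm.trans h1)

end Injection

section Blocks

variable {α : Type*} [LinearOrder α]

theorem List.replicate_lt_of_ne {a : α} (ha : ∀ c, a ≤ c) {v : List α}
    (hv : v ≠ List.replicate v.length a) : List.replicate v.length a < v := by
  induction v with
  | nil => simp at hv
  | cons c v ih =>
    rw [List.length_cons, List.replicate_succ] at hv ⊢
    rw [List.cons_lt_cons_iff]
    rcases (ha c).lt_or_eq with h | rfl
    · exact .inl h
    · exact .inr ⟨rfl, ih fun h => hv (by rw [← h])⟩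

theorem linked_of_window_eq_replicate {a b : α} (ha : ∀ c, a ≤ c) (hab : a ≠ b) {w : List α}
    {f : ℕ → α} {s l N : ℕ} (hw : window f s (l + 1 + N + l) <:+: w)
    (hstart : window f s (l + 1) = List.replicate l a ++ [b])
    (hend : window f (s + (l + 1 + N)) l = List.replicate l a) :
    Linked List.dropLast List.tail
      {e | e <:+: w ∧ e.length = l + 1 ∧ List.replicate l a ++ [b] < e}
      (List.replicate l a ++ [b]).tail (List.replicate l a) := by
  induction N using Nat.strong_induction_on with
  | _ N ih =>
  by_cases hret : ∃ i, 0 < i ∧ i < l + 1 + N ∧ window f (s + i) l = List.replicate l a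
  · obtain ⟨i, hi0, hiN, hi⟩ := hret
    have hfl : f (s + l) = b := by
      simpa [window] using congrArg (fun x => x[l]?) hstart
    have hli : l + 1 ≤ i := by
      by_contra! hlt
      have := congrArg (fun x => x[l - i]?) hi
      simp only [window, List.getElem?_map, List.getElem?_range' (show l - i < l by omega),
        List.getElem?_replicate, show l - i < l by omega, if_true, Option.map_some,
        Option.some_inj, one_mul] at this
      rw [add_assoc, show i + (l - i) = l by omega, hfl] at this
      exact hab this.symm
    obtain ⟨M, rfl⟩ := Nat.exists_eq_add_of_le hli
    refine ih M (by omega) (List.IsInfix.trans ?_ hw) hi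
    exact window_infix f (i := 0) (by omega)
  · rw [← hstart, tail_window, ← hend]
    refine linked_window (by omega) fun t h1 h2 => ⟨?_, by simp, ?_⟩
    · obtain ⟨i, rfl⟩ := Nat.exists_eq_add_of_le (show s ≤ t by omega)
      exact (window_infix f (by omega)).trans hw
    · rw [hstart, window_add]
      refine List.append_lt_append_of_lt ?_ (by simp) _ _
      have hne : window f t l ≠ List.replicate l a := fun h =>
        hret ⟨t - s, by omega, by omega, by rwa [Nat.add_sub_cancel' (by omega)]⟩
      have := List.replicate_lt_of_ne ha (v := window f t l)
      rw [length_window] at this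
      exact this hne

theorem removable_replicate_append {a b : α} (ha : ∀ c, a ≤ c) (hab : a ≠ b) {w z : List α} {l : ℕ}
    (h : List.replicate l a ++ [b] ++ z ++ List.replicate l a <:+: w) :
    Removable w (List.replicate l a ++ [b]) := by
  obtain ⟨s, -, hs⟩ := exists_window_eq_of_infix h a
  set f : ℕ → α := fun i => w.getD i a
  rw [show (List.replicate l a ++ [b] ++ z ++ List.replicate l a).length = l + 1 + z.length + l by
    simp; omega, window_add, window_add] at hs
  obtain ⟨h1, hend⟩ := List.append_inj hs (by simp; omega)
  obtain ⟨hstart, hz⟩ := List.append_inj h1 (by simp)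
  rw [hz, hstart, hend, ← window_add, ← window_add] at h
  have := linked_of_window_eq_replicate ha hab h hstart.symm hend.symm
  rw [Removable, List.dropLast_concat, List.length_append, List.length_replicate,
    List.length_singleton]
  exact .symm _ _ this

theorem card_powers_add_le {a b : α} (ha : ∀ c, a ≤ c) (hab : a ≠ b) {w z : List α} {L : ℕ}
    (hbw : b ∈ w) (haw : a ∈ w)
    (h : List.replicate L a ++ [b] ++ z ++ List.replicate L a <:+: w) :
    {v | v <:+: w ∧ IsPower v}.ncard + L + 2 ≤ w.length := by
  classical
  obtain ⟨F, hinj, hF⟩ := exists_injOn_isPower w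
  set P : Finset (List α) := (factors w).filter IsPower with hP
  have hPset : {v | v <:+: w ∧ IsPower v} = (P : Set (List α)) := by ext; simp [hP]
  rw [hPset] at hinj ⊢
  rw [Set.ncard_coe_finset]
  set B : Finset (List α) := (Finset.Icc 1 L).image fun l => List.replicate l a ++ [b] with hB
  have hBcard : B.card = L := by
    rw [hB, Finset.card_image_of_injective, Nat.card_Icc, Nat.add_sub_cancel]
    intro l l' hl
    simpa using congrArg List.length hl
  have hdisj : Disjoint (P.image F) B := by
    rw [Finset.disjoint_left]
    intro x hx hxB
    obtain ⟨v, hv, rfl⟩ := Finset.mem_image.1 hx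
    obtain ⟨l, -, hl⟩ := Finset.mem_image.1 hxB
    rw [hP, Finset.mem_filter, mem_factors] at hv
    exact (hF v hv.1 hv.2).2 l a b hab hl.symm
  have hsub : P.image F ∪ B ⊆ removableFactors w := by
    refine Finset.union_subset ?_ ?_
    · intro x hx
      obtain ⟨v, hv, rfl⟩ := Finset.mem_image.1 hx
      rw [hP, Finset.mem_filter, mem_factors] at hv
      exact (hF v hv.1 hv.2).1
    · intro x hx
      obtain ⟨l, hl, rfl⟩ := Finset.mem_image.1 hx
      obtain ⟨hl1, hlL⟩ := Finset.mem_Icc.1 hl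
      obtain ⟨M, rfl⟩ := Nat.exists_eq_add_of_le' hlL
      have hfac : List.replicate l a ++ [b] ++ z ++ List.replicate l a <:+: w := by
        refine List.IsInfix.trans ⟨List.replicate M a, List.replicate M a, ?_⟩ h
        simp only [List.append_assoc]
        rw [← List.replicate_add l M, add_comm l M, List.replicate_add M l, List.append_assoc]
      refine mem_removableFactors.2 ⟨?_, by simp; omega, removable_replicate_append ha hab hfac⟩
      rw [List.append_assoc] at hfac
      exact (List.prefix_append _ _).isInfix.trans hfac
  have hcard := Finset.card_le_card hsub
  rw [Finset.card_union_of_disjoint hdisj, Finset.card_image_of_injOn hinj, hBcard] at hcard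
  have hone : 2 ≤ (factorsOfLength w 1).card := by
    rw [← Finset.card_pair (a := [a]) (b := [b]) (by simpa using hab)]
    apply Finset.card_le_card
    intro x hx
    rw [mem_factorsOfLength]
    rcases Finset.mem_insert.1 hx with rfl | hx
    · exact ⟨(List.singleton_infix_iff _ _).2 haw, rfl⟩
    · rw [Finset.mem_singleton.1 hx]
      exact ⟨(List.singleton_infix_iff _ _).2 hbw, rfl⟩
  have := card_removableFactors_add_card_le (List.ne_nil_of_mem haw)
  omega

end Blocks

section Squares

variable {α : Type*} [LinearOrder α]

theorem numSquares_add_card_le {w : List α} {X : Finset (List α)}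
    (hX : ∀ x ∈ X, x <:+: w ∧ IsPower x ∧ ¬ ∃ u : List α, u ≠ [] ∧ x = u ++ u) :
    numSquares w + X.card ≤ numPowers w := by
  have hfin : {v : List α | v <:+: w ∧ IsPower v}.Finite :=
    (factors w).finite_toSet.subset fun v hv => by simpa using hv.1
  have hsq : {v : List α | v <:+: w ∧ ∃ u : List α, u ≠ [] ∧ v = u ++ u} ⊆
      {v : List α | v <:+: w ∧ IsPower v} := by
    rintro v ⟨hv, u, hu, rfl⟩
    exact ⟨hv, u, hu, 2, le_rfl, by simp [List.replicate_succ]⟩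
  have hdisj : Disjoint {v : List α | v <:+: w ∧ ∃ u : List α, u ≠ [] ∧ v = u ++ u}
      (X : Set (List α)) :=
    Set.disjoint_left.2 fun v hv hvX => (hX v hvX).2.2 hv.2
  rw [numSquares, ← Set.ncard_coe_finset X,
    ← Set.ncard_union_eq hdisj (hfin.subset hsq) X.finite_toSet]
  exact Set.ncard_le_ncard
    (Set.union_subset hsq fun v hv => ⟨(hX v hv).1, (hX v hv).2.1⟩) hfin

/-- The powers of odd exponent at least `3` of the letter `a` that are factors of `a ^ R`. -/
def oddLetterPowers [DecidableEq α] (a : α) (R : ℕ) : Finset (List α) :=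
  (Finset.range ((R - 1) / 2)).image fun i => List.replicate (2 * i + 3) a

theorem card_oddLetterPowers (a : α) (R : ℕ) : (oddLetterPowers a R).card = (R - 1) / 2 := by
  rw [oddLetterPowers, Finset.card_image_of_injective, Finset.card_range]
  intro i j h
  simpa using congrArg List.length h

theorem oddLetterPowers_spec {w x : List α} {a : α} {R : ℕ} (hw : List.replicate R a <:+: w)
    (hx : x ∈ oddLetterPowers a R) :
    x <:+: w ∧ IsPower x ∧ ¬ ∃ u : List α, u ≠ [] ∧ x = u ++ u := by
  obtain ⟨i, hi, rfl⟩ := Finset.mem_image.1 hx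
  rw [Finset.mem_range] at hi
  refine ⟨List.IsInfix.trans ?_ hw, ⟨[a], by simp, 2 * i + 3, by omega, by simp⟩, ?_⟩
  · obtain ⟨M, hM⟩ := Nat.exists_eq_add_of_le (show 2 * i + 3 ≤ R by omega)
    rw [hM, List.replicate_add _ M]
    exact (List.prefix_append _ _).isInfix
  · rintro ⟨u, -, hu⟩
    have := congrArg List.length hu
    simp at this
    omega

theorem numSquares_add_div_le {w : List α} {a : α} {R : ℕ} (hw : List.replicate R a <:+: w) :
    numSquares w + (R - 1) / 2 ≤ numPowers w := by
  rw [← card_oddLetterPowers a R]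
  exact numSquares_add_card_le fun x hx => oddLetterPowers_spec hw hx

theorem numSquares_add_div_add_one_le {w u : List α} {a b : α} (hab : a ≠ b) {R : ℕ}
    (hw : List.replicate R a <:+: w) (hu : u.count b = 1) (huw : u ++ u ++ u <:+: w) :
    numSquares w + ((R - 1) / 2 + 1) ≤ numPowers w := by
  have hne : u ≠ [] := by rintro rfl; simp at hu
  have hmem : u ++ u ++ u ∉ oddLetterPowers a R := by
    intro h
    obtain ⟨i, -, hi⟩ := Finset.mem_image.1 h
    have := congrArg (List.count b) hi
    simp [List.count_replicate, hab, hu] at this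
  rw [← card_oddLetterPowers a R, ← Finset.card_insert_of_notMem hmem]
  refine numSquares_add_card_le fun x hx => ?_
  rcases Finset.mem_insert.1 hx with rfl | hx
  · refine ⟨huw, ⟨u, hne, 3, by omega, by simp [List.replicate_succ]⟩, ?_⟩
    rintro ⟨v, -, hv⟩
    have := congrArg (List.count b) hv
    simp only [List.count_append, hu] at this
    omega
  · exact oddLetterPowers_spec hw hx

end Squares

section BinWord

/-- The word `a ^ r s b a ^ r (s + 1) b ⋯ a ^ r (s + n - 1) b`. -/
def blocks (r : ℕ → ℕ) (s n : ℕ) : List Bool :=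
  ((List.range' s n).map fun j => List.replicate (r j) false ++ [true]).flatten

theorem blocks_add (r : ℕ → ℕ) (s m n : ℕ) :
    blocks r s (m + n) = blocks r s m ++ blocks r (s + m) n := by
  simp [blocks, ← List.flatten_append, ← List.map_append]

@[simp] theorem blocks_zero (r : ℕ → ℕ) (s : ℕ) : blocks r s 0 = [] := rfl

theorem blocks_one (r : ℕ → ℕ) (s : ℕ) :
    blocks r s 1 = List.replicate (r s) false ++ [true] := by
  simp [blocks]

theorem binWord_eq (k : ℕ) (r : ℕ → ℕ) :
    binWord k (fun j => r j) = blocks r 0 k ++ List.replicate (r k) false := by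
  rw [binWord, blocks]
  congr 2
  apply List.ext_getElem <;> simp

theorem count_false_blocks (r : ℕ → ℕ) (n : ℕ) :
    (blocks r 0 n).count false = ∑ j ∈ Finset.range n, r j := by
  induction n with
  | zero => simp
  | succ n ih => simp [blocks_add, blocks_one, ih, Finset.sum_range_succ]

theorem count_true_blocks (r : ℕ → ℕ) (n : ℕ) : (blocks r 0 n).count true = n := by
  induction n with
  | zero => simp
  | succ n ih => simp [blocks_add, blocks_one, ih, List.count_replicate]

theorem count_false_binWord (k : ℕ) (r : ℕ → ℕ) :
    (binWord k fun j => r j).count false = ∑ j ∈ Finset.range (k + 1), r j := by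
  simp [binWord_eq, count_false_blocks, Finset.sum_range_succ]

theorem count_true_binWord (k : ℕ) (r : ℕ → ℕ) : (binWord k fun j => r j).count true = k := by
  simp [binWord_eq, count_true_blocks, List.count_replicate]

theorem replicate_prefix_blocks_append (r : ℕ → ℕ) (s n : ℕ) :
    List.replicate (r s) false <+: blocks r s n ++ List.replicate (r (s + n)) false := by
  cases n with
  | zero => simp
  | succ n =>
    rw [add_comm n, blocks_add, blocks_one, List.append_assoc, List.append_assoc]
    exact List.prefix_append _ _

theorem replicate_infix_binWord {k j : ℕ} (r : ℕ → ℕ) (hj : j ≤ k) :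
    List.replicate (r j) false <:+: binWord k fun j => r j := by
  obtain ⟨d, rfl⟩ := Nat.exists_eq_add_of_le hj
  rw [binWord_eq, blocks_add, List.append_assoc, zero_add]
  exact (replicate_prefix_blocks_append r j d).isInfix.trans (List.suffix_append _ _).isInfix

theorem exists_two_blocks_infix {k i j : ℕ} (r : ℕ → ℕ) (hij : i < j) (hj : j ≤ k) :
    ∃ z, List.replicate (r i) false ++ [true] ++ z ++ List.replicate (r j) false <:+:
      binWord k fun j => r j := by
  obtain ⟨d, rfl⟩ := Nat.exists_eq_add_of_le (Nat.succ_le_of_lt hij)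
  obtain ⟨e, rfl⟩ := Nat.exists_eq_add_of_le hj
  obtain ⟨y, hy⟩ := replicate_prefix_blocks_append r (i.succ + d) e
  refine ⟨blocks r (i + 1) d, blocks r 0 i, y, ?_⟩
  rw [binWord_eq, blocks_add, zero_add, List.append_assoc (blocks r 0 (i.succ + d)), ← hy]
  simp only [Nat.succ_eq_add_one, blocks_add, blocks_one, zero_add, List.append_assoc]

theorem exists_cube_infix {k j R : ℕ} {r : ℕ → ℕ} (hk : 3 ≤ k) (hj : j + 2 ≤ k) (h0 : r j = R)
    (h1 : r (j + 1) = R) (h2 : r (j + 2) = R) :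
    ∃ u : List Bool, u.count true = 1 ∧ u ++ u ++ u <:+: binWord k fun j => r j := by
  rcases hj.lt_or_eq with hlt | rfl
  · obtain ⟨e, rfl⟩ := Nat.exists_eq_add_of_le (show j + 1 + 1 + 1 ≤ k by omega)
    refine ⟨List.replicate R false ++ [true], by simp [List.count_replicate], blocks r 0 j,
      blocks r (j + 1 + 1 + 1) e ++ List.replicate (r (j + 1 + 1 + 1 + e)) false, ?_⟩
    rw [binWord_eq]
    simp only [blocks_add, blocks_one, zero_add, h0, h1, h2, List.append_assoc]
  · obtain ⟨i, rfl⟩ := Nat.exists_eq_add_of_le' (show 1 ≤ j by omega)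
    refine ⟨[true] ++ List.replicate R false, by simp [List.count_replicate],
      blocks r 0 i ++ List.replicate (r i) false, [], ?_⟩
    rw [binWord_eq, show i + 1 + 2 = i + 1 + 1 + 1 by rfl]
    simp only [blocks_add, blocks_one, zero_add, h0, h1, h2, List.append_assoc, List.append_nil]

theorem exists_three_consecutive_eq {k R : ℕ} {r : ℕ → ℕ} (hr : ∀ j ≤ k, r j ≤ R)
    (hsum : 3 * (k + 1) * R + 2 < k + 3 * ∑ j ∈ Finset.range (k + 1), r j) :
    ∃ j, j + 2 ≤ k ∧ r j = R ∧ r (j + 1) = R ∧ r (j + 2) = R := by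
  by_contra! hno
  have key : ∀ m ≤ k + 1, 3 * ∑ j ∈ Finset.range m, r j + m ≤ 3 * m * R + 2 := by
    intro m
    induction m using Nat.strong_induction_on with
    | _ m ih =>
    intro hm
    match m with
    | 0 => simp
    | 1 =>
      have := hr 0 (by omega)
      simp
      omega
    | 2 =>
      have := hr 0 (by omega)
      have := hr 1 (by omega)
      simp [Finset.sum_range_succ]
      omega
    | m + 3 =>
      have h := ih m (by omega) (by omega)
      have h0 := hr m (by omega)
      have h1 := hr (m + 1) (by omega)
      have h2 := hr (m + 2) (by omega)
      have h3 := hno m (by omega)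
      have h4 : r m + r (m + 1) + r (m + 2) + 1 ≤ 3 * R := by omega
      rw [Finset.sum_range_succ, Finset.sum_range_succ, Finset.sum_range_succ]
      linarith
  have := key (k + 1) le_rfl
  omega

end BinWord

/-- If the inequality `2 * (k + 1) * s ≤ (2 * k - 1) * (2 * k + δ)` fails, then the block lengths
are almost all equal. -/
theorem almost_constant_of_not_le {s m k δ R₁ R₂ F : ℕ}
    (hF : 3 * δ < 2 * (k + 1) * (F + 1)) (h : s + 1 + F ≤ m + R₂)
    (hm : m + R₂ + 2 ≤ 2 * k + δ) (hR : R₂ ≤ R₁) (hsum : k + δ ≤ k * R₂ + R₁)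
    (hs : s + (R₁ - 1) / 2 ≤ m)
    (hlt : 2 * k * (2 * k + δ) < 2 * (k + 1) * s + (2 * k + δ)) :
    3 ≤ k ∧ 3 * (k + 1) * R₁ + 2 < k + 3 * (k + δ) ∧ m < s + ((R₁ - 1) / 2 + 1) := by
  obtain ⟨T, hT⟩ : ∃ T, 2 * k + δ = s + F + 3 + T := ⟨2 * k + δ - (s + F + 3), by omega⟩
  have hT0 : T = 0 := by
    by_contra hne
    have : 1 ≤ T := Nat.one_le_iff_ne_zero.2 hne
    nlinarith
  subst hT0
  have hgap : 2 * (k + 1) * F + 6 < 3 * δ := by nlinarith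
  have hk : 3 ≤ k := by nlinarith
  have hF1 : F + 1 = R₂ + (m - s) := by omega
  obtain ⟨d, rfl⟩ := Nat.exists_eq_add_of_le hR
  have hd : d = 0 := by
    by_contra hne
    have h1 : 1 ≤ d := Nat.one_le_iff_ne_zero.2 hne
    have h2 : R₂ + d + 2 * R₂ ≤ 2 * F + 4 := by omega
    nlinarith
  subst hd
  rw [add_zero] at *
  refine ⟨hk, ?_, ?_⟩
  · have h2 : 3 * R₂ ≤ 2 * F + 4 := by omega
    nlinarith
  · by_contra! hge
    have h2 : 3 * R₂ ≤ 2 * F + 2 := by omega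
    nlinarith

theorem reduction_to_power_count
    (k : ℕ) (hk : 1 ≤ k) (r : Fin (k + 1) → ℕ) (δ n i : ℕ)
    (hab : (binWord k r).count true ≤ (binWord k r).count false)
    (hδ : (binWord k r).count false = k + δ)
    (hni : δ = n * (k + 1) + i) (hik : i ≤ k)
    (σ : Equiv.Perm (Fin (k + 1)))
    (hσ : Monotone fun j => r (σ j))
    (h : (numSquares (binWord k r) : ℤ) + 1 +
        ⌊(3 * (n : ℚ) / 2 + 3 * (i : ℚ) / (2 * ((k : ℚ) + 1)))⌋ ≤
      (numPowers (binWord k r) : ℤ) + r (σ ⟨k - 1, by omega⟩)) :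
    (numSquares (binWord k r) : ℚ) ≤ (2 * k - 1) / (2 * k + 2) * (binWord k r).length := by
  obtain ⟨r, rfl⟩ : ∃ r' : ℕ → ℕ, r = fun j : Fin (k + 1) => r' j :=
    ⟨fun j => if hj : j < k + 1 then r ⟨j, hj⟩ else 0, by ext j; simp [j.2]⟩
  set w := binWord k fun j => r j with hw
  have htrue : w.count true = k := count_true_binWord k r
  have hlen : w.length = 2 * k + δ := by
    rw [← List.count_true_add_count_false, htrue, hδ]
    omega
  have hsumr : ∑ j ∈ Finset.range (k + 1), r j = k + δ := by
    rw [← count_false_binWord, ← hw, hδ]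
  set p : Fin (k + 1) := ⟨k - 1, by omega⟩ with hp
  have hpne : σ p ≠ σ (Fin.last k) := fun he => by
    have := congrArg Fin.val (σ.injective he)
    simp [hp] at this
    omega
  have hR : r (σ p) ≤ r (σ (Fin.last k)) := hσ (Fin.le_last p)
  have hmax : ∀ j ≤ k, r j ≤ r (σ (Fin.last k)) := fun j hj => by
    have := hσ (Fin.le_last (σ.symm ⟨j, by omega⟩))
    simpa using this
  have hsum : k + δ ≤ k * r (σ p) + r (σ (Fin.last k)) := by
    rw [← hsumr, Finset.sum_range, ← Equiv.sum_comp σ fun j : Fin (k + 1) => r j,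
      Fin.sum_univ_castSucc]
    refine Nat.add_le_add_right ?_ _
    have := Finset.sum_le_card_nsmul Finset.univ (fun j : Fin k => r (σ j.castSucc)) (r (σ p))
      fun j _ => hσ (Fin.le_def.2 (by simp [hp]; omega))
    simpa using this
  have hblock := replicate_infix_binWord r (Nat.le_of_lt_succ (σ (Fin.last k)).2)
  obtain ⟨z, hz⟩ : ∃ z, List.replicate (r (σ p)) false ++ [true] ++ z ++
      List.replicate (r (σ p)) false <:+: w := by
    obtain ⟨M, hM⟩ := Nat.exists_eq_add_of_le hR
    rcases lt_or_gt_of_ne hpne with hlt | hlt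
    · obtain ⟨z, hz⟩ := exists_two_blocks_infix r hlt (Nat.le_of_lt_succ (σ (Fin.last k)).2)
      refine ⟨z, List.IsInfix.trans ⟨[], List.replicate M false, ?_⟩ hz⟩
      rw [hM, List.replicate_add]
      simp only [List.append_assoc, List.nil_append]
    · obtain ⟨z, hz⟩ := exists_two_blocks_infix r hlt (Nat.le_of_lt_succ (σ p).2)
      refine ⟨z, List.IsInfix.trans ⟨List.replicate M false, [], ?_⟩ hz⟩
      rw [hM, add_comm (r (σ p)) M, List.replicate_add M]
      simp only [List.append_assoc, List.append_nil]
  have hpow : numPowers w + r (σ p) + 2 ≤ 2 * k + δ := by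
    rw [← hlen]
    exact card_powers_add_le (a := false) (b := true) (by simp) (by simp)
      (List.count_pos_iff.1 (by omega)) (List.count_pos_iff.1 (by omega)) hz
  have hX : 3 * (n : ℚ) / 2 + 3 * (i : ℚ) / (2 * ((k : ℚ) + 1)) =
      ((3 * δ : ℕ) : ℚ) / ((2 * (k + 1) : ℕ) : ℚ) := by
    rw [hni]
    push_cast
    field_simp
  rw [hX, Rat.floor_natCast_div_natCast] at h
  have hF := Nat.lt_mul_div_succ (3 * δ) (show 0 < 2 * (k + 1) by omega)
  have h' : numSquares w + 1 + 3 * δ / (2 * (k + 1)) ≤ numPowers w + r (σ p) := by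
    exact_mod_cast h
  by_contra hcon
  have hlt : 2 * k * (2 * k + δ) < 2 * (k + 1) * numSquares w + (2 * k + δ) := by
    rw [not_le, hlen, div_mul_eq_mul_div, div_lt_iff₀ (by positivity)] at hcon
    push_cast at hcon
    have : (2 * k * (2 * k + δ) : ℚ) < 2 * (k + 1) * numSquares w + (2 * k + δ) := by linarith
    exact_mod_cast this
  obtain ⟨hk3, hbig, hfew⟩ := almost_constant_of_not_le hF h' hpow hR hsum
    (numSquares_add_div_le hblock) hlt
  rw [← hsumr] at hbig
  obtain ⟨j, hj, h0, h1, h2⟩ := exists_three_consecutive_eq hmax hbig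
  obtain ⟨u, hu, huw⟩ := exists_cube_infix hk3 hj h0 h1 h2
  exact absurd (numSquares_add_div_add_one_le (by simp) hblock hu huw) (not_le.2 hfew)
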